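/- Let f : ℝ → ℝ be continuous with F(u) = ∫₀^u f(s) ds. Suppose f satisfies condition (C) with constants ε, β, γ > 0 and β ≤ ελ₀/2, i.e. (2+ε) F(u) ≤ u f(u) + β u² + γ for all u > 0, and suppose f(u) ≥ λ u for all u > 0, where λ > λ₀. Then f satisfies condition (B): there exist ε' > 0 and γ' > 0 such that (2+ε') F(u) ≤ u f(u) + γ' for all u > 0 (indeed one may take ε' = ε − ελ₀/λ and γ' = γ). -/

import Mathlib

open Finset

/-- If a continuous `f` satisfies `f u ≥ c u` for `u > 0`, its primitive dominates `c u² / 2`. -/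
theorem mul_sq_div_two_le_integral {f : ℝ → ℝ} (hf : Continuous f) {c : ℝ}
    (h : ∀ u : ℝ, 0 < u → c * u ≤ f u) {u : ℝ} (hu : 0 ≤ u) :
    c * u ^ 2 / 2 ≤ ∫ s in (0:ℝ)..u, f s := by
  calc c * u ^ 2 / 2 = ∫ s in (0:ℝ)..u, c * s := by
        rw [intervalIntegral.integral_const_mul, integral_id]; ring
    _ ≤ ∫ s in (0:ℝ)..u, f s :=
        intervalIntegral.integral_mono_on_of_le_Ioo hu
          ((continuous_const.mul continuous_id).intervalIntegrable _ _)
          (hf.intervalIntegrable _ _) fun s hs => h s hs.1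

/-- **Condition (C) implies condition (B) for superlinear `f` (Lemma 4.1,
equivalence part).**
Network: finite `V = S̄`, nonempty interior `S`, nonempty boundary `Sᶜ`,
symmetric nonnegative weight `ω` vanishing on the diagonal; `λ₀` is the first
Dirichlet eigenvalue (minimum of the Rayleigh quotient over nonzero functions
vanishing on `∂S`).  Let `f : ℝ → ℝ` be continuous with `F u = ∫₀ᵘ f`.
Suppose `f` satisfies condition (C) with constants `ε, β, γ > 0`,
`β ≤ ελ₀/2`, and `f(u) ≥ λ u` for all `u > 0` with `λ > λ₀`.  Then `f`
satisfies condition (B): with `ε' = ε - ελ₀/λ > 0` and `γ' = γ` one has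
`(2+ε') F(u) ≤ u f(u) + γ'` for all `u > 0`. -/
theorem conditionC_implies_conditionB {V : Type*} [Fintype V] [DecidableEq V]
    (S : Finset V) (hS : S.Nonempty) (hSc : Sᶜ.Nonempty)
    (ω : V → V → ℝ)
    (hsymm : ∀ x y, ω x y = ω y x)
    (hnonneg : ∀ x y, 0 ≤ ω x y)
    (hdiag : ∀ x, ω x x = 0)
    (lam0 : ℝ)
    (hlam0 : IsLeast {r : ℝ | ∃ w : V → ℝ, (∀ x ∉ S, w x = 0) ∧ w ≠ 0 ∧
        r = ((1 / 2) * ∑ x, ∑ y, (w x - w y) ^ 2 * ω x y) / (∑ x, (w x) ^ 2)} lam0)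
    (f : ℝ → ℝ) (hf : Continuous f)
    (ε β γ : ℝ) (hε : 0 < ε) (hβ : 0 < β) (hγ : 0 < γ)
    (hβle : β ≤ ε * lam0 / 2)
    (hC : ∀ u : ℝ, 0 < u →
      (2 + ε) * (∫ s in (0:ℝ)..u, f s) ≤ u * f u + β * u ^ 2 + γ)
    (lam : ℝ) (hlamgt : lam0 < lam)
    (hflin : ∀ u : ℝ, 0 < u → lam * u ≤ f u) :
    0 < ε - ε * lam0 / lam ∧
      ∀ u : ℝ, 0 < u →
        (2 + (ε - ε * lam0 / lam)) * (∫ s in (0:ℝ)..u, f s) ≤ u * f u + γ := by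
  have hlam0_pos : 0 < lam0 := by
    by_contra! h
    nlinarith [mul_nonneg hε.le (neg_nonneg.mpr h)]
  have hlam : 0 < lam := hlam0_pos.trans hlamgt
  refine ⟨sub_pos.mpr ((div_lt_iff₀ hlam).mpr (mul_lt_mul_of_pos_left hlamgt hε)), fun u hu => ?_⟩
  have hF : ε * lam0 / lam * (lam * u ^ 2 / 2) ≤ ε * lam0 / lam * ∫ s in (0:ℝ)..u, f s :=
    mul_le_mul_of_nonneg_left (mul_sq_div_two_le_integral hf hflin hu.le) (by positivity)
  have hcancel : ε * lam0 / lam * (lam * u ^ 2 / 2) = ε * lam0 / 2 * u ^ 2 := by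
    field_simp
  have hβu : β * u ^ 2 ≤ ε * lam0 / 2 * u ^ 2 :=
    mul_le_mul_of_nonneg_right hβle (sq_nonneg u)
  linarith [hC u hu]
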